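/- For all 1 ≤ n ≤ k ≤ N, setting Y_k := −Q·A_k + X_k + q_k·S_k and Y := −Q·A + x + q·S, one has the identity Y_k − Y = σ√δt·( Σ_{j=n}^{k−1} ( q_j − (1 − j/k)·Q )·ε_{j+1} − (1 − n/k)·Q·(S − A)/(σ√δt) ) + Σ_{j=n}^{k−1} L(v_j / V_{j+1})·V_{j+1}·δt. -/

import Mathlib

theorem sum_Ico_sum_Ico_succ (a : ℕ → ℝ) {n k : ℕ} (hnk : n ≤ k) :
    ∑ j ∈ Finset.Ico n k, ∑ i ∈ Finset.Ico n (j + 1), a i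
      = ∑ j ∈ Finset.Ico n k, ((k : ℝ) - j) * a j := by
  induction k, hnk using Nat.le_induction with
  | base => simp
  | succ k hk ih =>
    rw [Finset.sum_Ico_succ_top hk, ih, Finset.sum_Ico_succ_top hk, Finset.sum_Ico_succ_top hk,
      ← add_assoc, ← Finset.sum_add_distrib]
    push_cast
    congr 1
    · exact Finset.sum_congr rfl fun j _ => by ring
    · ring

theorem mul_sub_mul_eq_sum_Ico (f g : ℕ → ℝ) {n k : ℕ} (hnk : n ≤ k) :
    f k * g k - f n * g n
      = ∑ j ∈ Finset.Ico n k, (f j * (g (j + 1) - g j) + (f (j + 1) - f j) * g (j + 1)) := by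
  rw [← Finset.sum_Ico_sub (fun j => f j * g j) hnk]
  exact Finset.sum_congr rfl fun j _ => by ring

/-- For all `1 ≤ n ≤ k ≤ N`, setting `Y_k := −Q·A_k + X_k + q_k·S_k` and
`Y := −Q·A + x + q·S`, one has
`Y_k − Y = σ√δt·( Σ_{j=n}^{k−1} (q_j − (1 − j/k)·Q)·ε_{j+1} − (1 − n/k)·Q·(S−A)/(σ√δt) )
  + Σ_{j=n}^{k−1} L(v_j/V_{j+1})·V_{j+1}·δt`. -/
theorem stmt0 (N : ℕ) (hN : 1 ≤ N) (δt σ Q : ℝ) (hδt : 0 < δt) (hσ : 0 < σ)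
    (x q S A : ℝ) (ε : ℕ → ℝ) (v : ℕ → ℝ) (V : ℕ → ℝ)
    (hV : ∀ j, 1 ≤ j → j ≤ N → 0 < V j) (L : ℝ → ℝ)
    (n k : ℕ) (hn : 1 ≤ n) (hnk : n ≤ k) (hkN : k ≤ N)
    (Xp qp Sp Ap : ℕ → ℝ)
    (hS : ∀ i, Sp i = S + σ * Real.sqrt δt * ∑ j ∈ Finset.Ico n i, ε (j + 1))
    (hX : ∀ i, Xp i = x + ∑ j ∈ Finset.Ico n i,
      (v j * Sp (j + 1) * δt + L (v j / V (j + 1)) * V (j + 1) * δt))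
    (hq : ∀ i, qp i = q - ∑ j ∈ Finset.Ico n i, v j * δt)
    (hA : ∀ i, Ap i = ((n : ℝ) / (i : ℝ)) * A
      + (1 / (i : ℝ)) * ∑ j ∈ Finset.Ico n i, Sp (j + 1)) :
    (-(Q * Ap k) + Xp k + qp k * Sp k) - (-(Q * A) + x + q * S)
      = σ * Real.sqrt δt *
          ((∑ j ∈ Finset.Ico n k, (qp j - (1 - (j : ℝ) / (k : ℝ)) * Q) * ε (j + 1))
            - (1 - (n : ℝ) / (k : ℝ)) * Q * ((S - A) / (σ * Real.sqrt δt)))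
        + ∑ j ∈ Finset.Ico n k, L (v j / V (j + 1)) * V (j + 1) * δt := by
  set c := σ * Real.sqrt δt with hc
  have hc0 : c ≠ 0 := (mul_pos hσ (Real.sqrt_pos.mpr hδt)).ne'
  have hk0 : (k : ℝ) ≠ 0 := by
    have : k ≠ 0 := by omega
    exact_mod_cast this
  have hqn : qp n = q := by simp [hq]
  have hSn : Sp n = S := by simp [hS]
  have hprod : qp k * Sp k - q * S = c * ∑ j ∈ Finset.Ico n k, qp j * ε (j + 1)
      - ∑ j ∈ Finset.Ico n k, v j * Sp (j + 1) * δt := by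
    have h := mul_sub_mul_eq_sum_Ico qp Sp hnk
    rw [hqn, hSn] at h
    rw [h, Finset.mul_sum, ← Finset.sum_sub_distrib]
    refine Finset.sum_congr rfl fun j hj => ?_
    have hnj := (Finset.mem_Ico.mp hj).1
    have hSj : Sp (j + 1) - Sp j = c * ε (j + 1) := by
      rw [hS, hS, Finset.sum_Ico_succ_top hnj]
      ring
    have hqj : qp (j + 1) - qp j = -(v j * δt) := by
      rw [hq, hq, Finset.sum_Ico_succ_top hnj]
      ring
    rw [hSj, hqj]
    ring
  have hsum : ∑ j ∈ Finset.Ico n k, Sp (j + 1)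
      = ((k : ℝ) - n) * S + c * ∑ j ∈ Finset.Ico n k, ((k : ℝ) - j) * ε (j + 1) := by
    rw [← sum_Ico_sum_Ico_succ (fun j => ε (j + 1)) hnk]
    simp [hS, Finset.sum_add_distrib, Finset.mul_sum, Nat.cast_sub hnk]
  have hsplit : ∑ j ∈ Finset.Ico n k, (qp j - (1 - (j : ℝ) / k) * Q) * ε (j + 1)
      = ∑ j ∈ Finset.Ico n k, qp j * ε (j + 1)
        - Q / k * ∑ j ∈ Finset.Ico n k, ((k : ℝ) - j) * ε (j + 1) := by
    rw [Finset.mul_sum, ← Finset.sum_sub_distrib]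
    refine Finset.sum_congr rfl fun j _ => ?_
    field_simp
  rw [hsplit, hA, hX, hsum, Finset.sum_add_distrib]
  rw [sub_eq_iff_eq_add] at hprod
  rw [hprod]
  generalize ∑ j ∈ Finset.Ico n k, v j * Sp (j + 1) * δt = T
  generalize ∑ j ∈ Finset.Ico n k, L (v j / V (j + 1)) * V (j + 1) * δt = U
  field_simp
  ring
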